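/- arXiv:2511.03111 — 2 statements merged into one kernel-verified Lean document; each statement's English description precedes it below -/
import Mathlib

section
/- The function f̃ is Lipschitz continuous on ℝ with Lipschitz constant 1/2: for all a, b ∈ ℝ, |f̃(a) − f̃(b)| ≤ ½|a − b|. -/
/-- The derivative candidate f̃ of the truncated potential. -/
noncomputable def ftilde (x : ℝ) : ℝ :=
  if 1 < x then (1/2) * (x - 1)
  else if x < 0 then (1/2) * x
  else x^3 - (3/2) * x^2 + (1/2) * x

/-- `f̃` is the linear function `x / 2` minus a cubic evaluated at the clamp of `x` to `[0, 1]`. -/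
theorem ftilde_eq_half_sub_clamp (x : ℝ) :
    ftilde x = x / 2 - (3 / 2 * (max 0 (min x 1)) ^ 2 - (max 0 (min x 1)) ^ 3) := by
  unfold ftilde
  split_ifs with h1 h0
  · rw [min_eq_right h1.le, max_eq_right zero_le_one]; ring
  · rw [min_eq_left (by linarith), max_eq_left h0.le]; ring
  · rw [min_eq_left (not_lt.mp h1), max_eq_right (not_lt.mp h0)]; ring

theorem clamp_sub_clamp_le {a b : ℝ} (h : a ≤ b) :
    max 0 (min b 1) - max 0 (min a 1) ≤ b - a := by
  grind

theorem cubic_slope_mem_Icc {c d : ℝ} (hc0 : 0 ≤ c) (hc1 : c ≤ 1) (hd0 : 0 ≤ d) (hd1 : d ≤ 1) :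
    3 / 2 * (d + c) - (d ^ 2 + d * c + c ^ 2) ∈ Set.Icc (0 : ℝ) 1 := by
  constructor
  · nlinarith [mul_nonneg hc0 (sub_nonneg.2 hc1), mul_nonneg hd0 (sub_nonneg.2 hd1),
      mul_nonneg hc0 (sub_nonneg.2 hd1), mul_nonneg hd0 (sub_nonneg.2 hc1)]
  · nlinarith [sq_nonneg (c - d), sq_nonneg (c + d - 1)]

theorem abs_ftilde_sub_le_of_le {a b : ℝ} (h : a ≤ b) :
    |ftilde b - ftilde a| ≤ 1 / 2 * (b - a) := by
  have hcd : max 0 (min a 1) ≤ max 0 (min b 1) := by gcongr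
  have hle := clamp_sub_clamp_le h
  have hslope := cubic_slope_mem_Icc (le_max_left 0 (min a 1))
    (max_le zero_le_one (min_le_right a 1)) (le_max_left 0 (min b 1))
    (max_le zero_le_one (min_le_right b 1))
  rw [ftilde_eq_half_sub_clamp, ftilde_eq_half_sub_clamp]
  generalize max 0 (min a 1) = c at *
  generalize max 0 (min b 1) = d at *
  have hlow := mul_nonneg (sub_nonneg.2 hcd) hslope.1
  have hupp := mul_nonneg (sub_nonneg.2 hcd) (sub_nonneg.2 hslope.2)
  rw [abs_le]
  constructor <;> linarith

/-- f̃ is Lipschitz continuous on ℝ with Lipschitz constant 1/2. -/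
theorem ftilde_lipschitz :
    ∀ a b : ℝ, |ftilde a - ftilde b| ≤ (1/2) * |a - b| := by
  intro a b
  rcases le_total a b with h | h
  · rw [abs_sub_comm, abs_sub_comm a b, abs_of_nonneg (sub_nonneg.2 h)]
    exact abs_ftilde_sub_le_of_le h
  · rw [abs_of_nonneg (sub_nonneg.2 h)]
    exact abs_ftilde_sub_le_of_le h
end

section
/- For all a, b ∈ ℝ one has |(f̃(a) + ½ f̃′(a)(b − a))·(b − a) − (F̃(b) − F̃(a))| ≤ ½ (b − a)². -/
/-- The truncated double-well potential F̃. -/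
noncomputable def Ftilde (x : ℝ) : ℝ :=
  if 1 < x then (1/4) * (x - 1)^2
  else if x < 0 then (1/4) * x^2
  else (1/4) * x^2 * (1 - x)^2

/-- The second-derivative candidate f̃′ of the truncated potential. -/
noncomputable def ftilde' (x : ℝ) : ℝ :=
  if 1 < x then 1/2
  else if x < 0 then 1/2
  else 3 * x^2 - 3 * x + 1/2

theorem abs_ftilde'_le (x : ℝ) : |ftilde' x| ≤ 1 / 2 := by
  unfold ftilde'
  rw [abs_le]
  split_ifs <;> constructor <;> nlinarith [sq_nonneg (x - 1 / 2)]

theorem neg_quarter_sq_le_quadratic_sub_tangent {a b : ℝ} (ha : 0 ≤ a) (hb : b < 0) :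
    -(1 / 4 * (b - a) ^ 2) ≤
      1 / 4 * b ^ 2 - 1 / 4 * a ^ 2 * (1 - a) ^ 2
        - (a ^ 3 - 3 / 2 * a ^ 2 + 1 / 2 * a) * (b - a) := by
  have h₁ : 0 ≤ a * (2 * a ^ 2 - 3 * a + 2) * -b :=
    mul_nonneg (mul_nonneg ha (by nlinarith [sq_nonneg (4 * a - 3)])) (by linarith)
  have h₂ : 0 ≤ a ^ 2 * (3 * a ^ 2 - 4 * a + 2) :=
    mul_nonneg (sq_nonneg a) (by nlinarith [sq_nonneg (3 * a - 2)])
  nlinarith [sq_nonneg b]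

theorem quadratic_sub_tangent_le_quarter_sq {a b : ℝ} (ha : 0 ≤ a) (ha' : a ≤ 1) (hb : b < 0) :
    1 / 4 * b ^ 2 - 1 / 4 * a ^ 2 * (1 - a) ^ 2
        - (a ^ 3 - 3 / 2 * a ^ 2 + 1 / 2 * a) * (b - a) ≤ 1 / 4 * (b - a) ^ 2 := by
  have h₁ : 0 ≤ a ^ 2 * (3 - 2 * a) * -b :=
    mul_nonneg (mul_nonneg (sq_nonneg a) (by linarith)) (by linarith)
  have h₂ : 0 ≤ a ^ 3 * (4 - 3 * a) := mul_nonneg (pow_nonneg ha 3) (by linarith)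
  nlinarith

theorem quartic_well_le_quarter_sq {x : ℝ} (hx : 0 ≤ x) (hx' : x ≤ 1) :
    1 / 4 * x ^ 2 * (1 - x) ^ 2 ≤ 1 / 4 * x ^ 2 := by
  nlinarith [mul_nonneg (pow_nonneg hx 3) (by linarith : 0 ≤ 2 - x)]

theorem quartic_sub_tangent_le_quarter_sq {a b : ℝ} (ha : 0 ≤ a) (ha' : a ≤ 1) (hb : 0 ≤ b)
    (hb' : b ≤ 1) :
    1 / 4 * b ^ 2 * (1 - b) ^ 2 - 1 / 4 * a ^ 2 * (1 - a) ^ 2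
        - (a ^ 3 - 3 / 2 * a ^ 2 + 1 / 2 * a) * (b - a) ≤ 1 / 4 * (b - a) ^ 2 := by
  have hq : 0 ≤ 3 * (a * (1 - a)) + b * (1 - b) + a * (1 - b) + b * (1 - a) := by
    have := sub_nonneg.mpr ha'
    have := sub_nonneg.mpr hb'
    positivity
  nlinarith [mul_nonneg (sq_nonneg (b - a)) hq]

theorem neg_quarter_sq_le_quartic_sub_tangent (a b : ℝ) :
    -(1 / 4 * (b - a) ^ 2) ≤
      1 / 4 * b ^ 2 * (1 - b) ^ 2 - 1 / 4 * a ^ 2 * (1 - a) ^ 2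
        - (a ^ 3 - 3 / 2 * a ^ 2 + 1 / 2 * a) * (b - a) := by
  have hq : 0 ≤ 3 * a ^ 2 + 2 * a * b + b ^ 2 - 4 * a - 2 * b + 2 := by
    nlinarith [sq_nonneg (a + b - 1), sq_nonneg (2 * a - 1)]
  nlinarith [mul_nonneg (sq_nonneg (b - a)) hq]

/-- First-order Taylor bound for `Ftilde`, whose derivative `ftilde` is `1/2`-Lipschitz. -/
theorem abs_Ftilde_sub_sub_le (a b : ℝ) :
    |Ftilde b - Ftilde a - ftilde a * (b - a)| ≤ 1 / 4 * (b - a) ^ 2 := by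
  unfold Ftilde ftilde
  rw [abs_le]
  split_ifs with hb₁ ha₁ ha₀ hb₀ ha₁ ha₀ ha₁ ha₀
  · constructor <;> nlinarith [sq_nonneg (b - a)]
  · constructor <;> nlinarith
  · have hb : 1 - b < 0 := by linarith
    have ha : 0 ≤ 1 - a := by linarith
    have h₁ := neg_quarter_sq_le_quadratic_sub_tangent ha hb
    have h₂ := quadratic_sub_tangent_le_quarter_sq ha (by linarith) hb
    constructor <;> linarith
  · constructor <;> nlinarith
  · constructor <;> nlinarith [sq_nonneg (b - a)]
  · have h₁ := neg_quarter_sq_le_quadratic_sub_tangent (not_lt.mp ha₀) hb₀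
    have h₂ := quadratic_sub_tangent_le_quarter_sq (not_lt.mp ha₀) (not_lt.mp ha₁) hb₀
    constructor <;> linarith
  · have h := quartic_well_le_quarter_sq (x := 1 - b) (by linarith) (by linarith)
    constructor <;> nlinarith [sq_nonneg (b * (1 - b))]
  · have h := quartic_well_le_quarter_sq (x := b) (by linarith) (by linarith)
    constructor <;> nlinarith [sq_nonneg (b * (1 - b))]
  · rw [not_lt] at *
    exact ⟨neg_quarter_sq_le_quartic_sub_tangent a b, quartic_sub_tangent_le_quarter_sq ha₀ ha₁ hb₀ hb₁⟩

/-- Pointwise bound on the numerical dissipation of the OD2 approximation of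
the truncated nonlinearity:
|(f̃(a) + ½f̃′(a)(b − a))(b − a) − (F̃(b) − F̃(a))| ≤ ½(b − a)². -/
theorem od2_dissipation_bound :
    ∀ a b : ℝ,
      |(ftilde a + (1/2) * ftilde' a * (b - a)) * (b - a) - (Ftilde b - Ftilde a)|
        ≤ (1/2) * (b - a)^2 := by
  intro a b
  have hT := abs_le.mp (abs_Ftilde_sub_sub_le a b)
  have hf := abs_le.mp (abs_ftilde'_le a)
  have hsq := sq_nonneg (b - a)
  rw [abs_le]
  constructor <;> nlinarith
end
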